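/- arXiv:1011.5953 — 2 statements merged into one kernel-verified Lean document; each statement's English description precedes it below -/
import Mathlib

section
/- Let φ ∈ GL_n(ℤ) be a hyperbolic automorphism of ℤⁿ, diagonalizable over ℝ with all eigenvalues positive. For nonzero z, w ∈ ℤⁿ and nonzero a ∈ ℤⁿ, the intersection of the orbit O_z = {φⁱ(z) : i ∈ ℤ} with the translate a + O_w = {a + φⁱ(w) : i ∈ ℤ} contains at most 2 points. -/
open Filter Topology

/-- If `exp y` is a proper convex combination of `exp x` and `1`, then `y` lies strictly between
`0` and `x`, and above the corresponding convex combination of the exponents. -/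
theorem exp_combination_of_mem_Ioo {p x y : ℝ} (hp0 : 0 < p) (hp1 : p < 1) (hx : x ≠ 0)
    (h : p * Real.exp x + (1 - p) = Real.exp y) :
    p * x < y ∧ 0 < x * y ∧ x * y < x * x := by
  refine ⟨?_, ?_⟩
  · have := strictConvexOn_exp.2 (Set.mem_univ x) (Set.mem_univ 0) hx hp0
      (sub_pos.2 hp1) (by ring)
    simp only [smul_eq_mul, Real.exp_zero, mul_one, mul_zero, add_zero, h] at this
    exact Real.exp_lt_exp.1 this
  · rcases lt_or_gt_of_ne hx with hx | hx
    · have hexp : Real.exp x < 1 := Real.exp_lt_one_iff.2 hx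
      have hy : y < 0 := Real.exp_lt_one_iff.1 (by rw [← h]; nlinarith)
      have hxy : x < y := Real.exp_lt_exp.1 (by rw [← h]; nlinarith)
      constructor <;> nlinarith
    · have hexp : 1 < Real.exp x := Real.one_lt_exp_iff.2 hx
      have hy : 0 < y := Real.one_lt_exp_iff.1 (by rw [← h]; nlinarith)
      have hxy : y < x := Real.exp_lt_exp.1 (by rw [← h]; nlinarith)
      constructor <;> nlinarith

theorem exp_combination_of_one_lt {p x y : ℝ} (hp : 1 < p) (hx : x ≠ 0)
    (h : p * Real.exp x + (1 - p) = Real.exp y) :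
    y < p * x ∧ x * x < x * y := by
  have hp0 : 0 < p := by linarith
  have hy : y ≠ 0 := by
    rintro rfl
    rw [Real.exp_zero] at h
    exact hx ((Real.exp_eq_one_iff x).1 (mul_left_cancel₀ hp0.ne' (by linarith)))
  obtain ⟨h1, h2, h3⟩ := exp_combination_of_mem_Ioo (inv_pos.2 hp0) (inv_lt_one_of_one_lt₀ hp) hy
    (y := x) (by rw [← h]; field_simp; ring)
  refine ⟨?_, ?_⟩
  · rwa [inv_mul_lt_iff₀ hp0] at h1
  · rcases lt_or_gt_of_ne hy with hy | hy
    · have hx' : x < 0 := by nlinarith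
      nlinarith
    · have hx' : 0 < x := by nlinarith
      nlinarith

theorem exp_combination_of_neg {p x y : ℝ} (hp : p < 0) (hx : x ≠ 0)
    (h : p * Real.exp x + (1 - p) = Real.exp y) :
    y < p * x ∧ x * y < 0 := by
  have hq : 0 < 1 - p := by linarith
  have hyx : y - x ≠ 0 := by
    intro hyx
    rw [sub_eq_zero.1 hyx] at h
    exact hx ((Real.exp_eq_one_iff x).1 (mul_left_cancel₀ hq.ne' (by linarith)))
  obtain ⟨h1, h2, h3⟩ := exp_combination_of_mem_Ioo (inv_pos.2 hq)
    (inv_lt_one_of_one_lt₀ (by linarith : 1 < 1 - p)) hyx (y := -x) (by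
      rw [Real.exp_sub, Real.exp_neg, ← h]
      field_simp
      ring)
  refine ⟨?_, ?_⟩
  · rw [inv_mul_lt_iff₀ hq] at h1
    linarith
  · nlinarith

/-- Three points of the plane whose images under `(u, v) ↦ (exp (t * u), exp (t * v))` lie on a
common line (not through the origin, nor parallel to an axis): the sign of `t` times the
orientation of the triangle is determined by the slope of an edge. -/
theorem orientation_of_exp_collinear {t p d₁ d₃ e₁ e₃ : ℝ} (ht : t ≠ 0) (hp0 : p ≠ 0)
    (hp1 : p ≠ 1) (hd₁ : 0 < d₁) (hd₃ : 0 < d₃)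
    (h₁ : p * Real.exp (t * -d₁) + (1 - p) = Real.exp (t * -e₁))
    (h₃ : p * Real.exp (t * d₃) + (1 - p) = Real.exp (t * e₃)) :
    (0 < e₃ ∧ e₃ < d₃ ∧ 0 < t * (d₁ * e₃ - d₃ * e₁)) ∨
      (d₃ < e₃ ∧ t * (d₁ * e₃ - d₃ * e₁) < 0) ∨
      (e₃ < 0 ∧ t * (d₁ * e₃ - d₃ * e₁) < 0) := by
  have hx₁ : t * -d₁ ≠ 0 := mul_ne_zero ht (neg_ne_zero.2 hd₁.ne')
  have hx₃ : t * d₃ ≠ 0 := mul_ne_zero ht hd₃.ne'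
  have htt : 0 < t * t * d₃ := mul_pos (mul_self_pos.2 ht) hd₃
  rcases lt_or_gt_of_ne hp0 with hp | hp
  · obtain ⟨a₁, -⟩ := exp_combination_of_neg hp hx₁ h₁
    obtain ⟨a₃, b₃⟩ := exp_combination_of_neg hp hx₃ h₃
    refine Or.inr (Or.inr ⟨?_, ?_⟩)
    · by_contra! h
      nlinarith [mul_nonneg htt.le h]
    · nlinarith [mul_pos hd₁ (sub_pos.2 a₃), mul_pos hd₃ (sub_pos.2 a₁)]
  · rcases lt_or_gt_of_ne hp1 with hp' | hp'
    · obtain ⟨a₁, -⟩ := exp_combination_of_mem_Ioo hp hp' hx₁ h₁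
      obtain ⟨a₃, b₃, c₃⟩ := exp_combination_of_mem_Ioo hp hp' hx₃ h₃
      refine Or.inl ⟨?_, ?_, ?_⟩
      · by_contra! h
        nlinarith [mul_nonneg htt.le (neg_nonneg.2 h)]
      · by_contra! h
        nlinarith [mul_nonneg htt.le (sub_nonneg.2 h)]
      · nlinarith [mul_pos hd₁ (sub_pos.2 a₃), mul_pos hd₃ (sub_pos.2 a₁)]
    · obtain ⟨a₁, -⟩ := exp_combination_of_one_lt hp' hx₁ h₁
      obtain ⟨a₃, b₃⟩ := exp_combination_of_one_lt hp' hx₃ h₃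
      refine Or.inr (Or.inl ⟨?_, ?_⟩)
      · by_contra! h
        nlinarith [mul_nonneg htt.le (sub_nonneg.2 h)]
      · nlinarith [mul_pos hd₁ (sub_pos.2 a₃), mul_pos hd₃ (sub_pos.2 a₁)]

theorem exp_combination_of_zpow {r α β γ : ℝ} (hr : 0 < r) (hβ : β ≠ 0) {i j i' j' : ℤ}
    (h : α * r ^ i = γ + β * r ^ j) (h' : α * r ^ i' = γ + β * r ^ j') :
    α * r ^ i / (β * r ^ j) * Real.exp (Real.log r * ((i' : ℝ) - i)) +
      (1 - α * r ^ i / (β * r ^ j)) = Real.exp (Real.log r * ((j' : ℝ) - j)) := by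
  have key (k l : ℤ) : Real.exp (Real.log r * ((k : ℝ) - l)) = r ^ k / r ^ l := by
    rw [← Real.rpow_def_of_pos hr, ← Int.cast_sub, Real.rpow_intCast, zpow_sub₀ hr.ne']
  have hi := zpow_ne_zero i hr.ne'
  have hj := zpow_ne_zero j hr.ne'
  rw [key, key]
  field_simp
  linarith

/-- The orientation lemma for three solutions of `α * r ^ i = γ + β * r ^ j`. -/
theorem orientation_of_zpow_solutions {r α β γ : ℝ} (hr : 0 < r) (hr1 : r ≠ 1)
    (hα : α ≠ 0) (hβ : β ≠ 0) (hγ : γ ≠ 0) {i₁ i₂ i₃ j₁ j₂ j₃ : ℤ}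
    (hi : i₁ < i₂) (hi' : i₂ < i₃)
    (h₁ : α * r ^ i₁ = γ + β * r ^ j₁) (h₂ : α * r ^ i₂ = γ + β * r ^ j₂)
    (h₃ : α * r ^ i₃ = γ + β * r ^ j₃) :
    let d₁ : ℝ := (i₂ : ℝ) - i₁
    let d₃ : ℝ := (i₃ : ℝ) - i₂
    let e₁ : ℝ := (j₂ : ℝ) - j₁
    let e₃ : ℝ := (j₃ : ℝ) - j₂
    (0 < e₃ ∧ e₃ < d₃ ∧ 0 < Real.log r * (d₁ * e₃ - d₃ * e₁)) ∨
      (d₃ < e₃ ∧ Real.log r * (d₁ * e₃ - d₃ * e₁) < 0) ∨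
      (e₃ < 0 ∧ Real.log r * (d₁ * e₃ - d₃ * e₁) < 0) := by
  intro d₁ d₃ e₁ e₃
  have hlog : Real.log r ≠ 0 := Real.log_ne_zero_of_pos_of_ne_one hr hr1
  have hX := zpow_ne_zero i₂ hr.ne'
  have hY := zpow_ne_zero j₂ hr.ne'
  refine orientation_of_exp_collinear (p := α * r ^ i₂ / (β * r ^ j₂)) hlog
    (div_ne_zero (mul_ne_zero hα hX) (mul_ne_zero hβ hY)) ?_
    (sub_pos.2 (Int.cast_lt.2 hi)) (sub_pos.2 (Int.cast_lt.2 hi')) ?_ ?_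
  · intro h
    rw [div_eq_one_iff_eq (mul_ne_zero hβ hY)] at h
    exact hγ (by linarith)
  · have := exp_combination_of_zpow hr hβ h₂ h₁
    rwa [← neg_sub (i₂ : ℝ), ← neg_sub (j₂ : ℝ)] at this
  · exact exp_combination_of_zpow hr hβ h₂ h₃

theorem coeffs_ne_zero_of_zpow_solutions {r α β γ : ℝ} (hr : 0 < r) (hr1 : r ≠ 1)
    {i i' j j' : ℤ} (hi : i ≠ i') (hd : i - j ≠ i' - j')
    (h : α * r ^ i = γ + β * r ^ j) (h' : α * r ^ i' = γ + β * r ^ j') (hα : α ≠ 0) :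
    β ≠ 0 ∧ γ ≠ 0 := by
  have hβ : β ≠ 0 := by
    rintro rfl
    exact hi (zpow_right_injective₀ hr hr1 (mul_left_cancel₀ hα (by linarith)))
  refine ⟨hβ, ?_⟩
  rintro rfl
  refine hd (zpow_right_injective₀ hr hr1 (mul_left_cancel₀ hα ?_))
  have hj₁ := zpow_ne_zero j hr.ne'
  have hj₂ := zpow_ne_zero j' hr.ne'
  have e₁ : α * r ^ (i - j) = β := by
    rw [zpow_sub₀ hr.ne']; field_simp; linarith
  have e₂ : α * r ^ (i' - j') = β := by
    rw [zpow_sub₀ hr.ne']; field_simp; linarith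
  exact e₁.trans e₂.symm

theorem const_eq_zero_of_zpow_solutions {r α β γ : ℝ} (hr : 0 < r) (hr1 : r ≠ 1)
    {i i' j j' : ℤ} (hj : j ≠ j') (hd : i - j = i' - j')
    (h : α * r ^ i = γ + β * r ^ j) (h' : α * r ^ i' = γ + β * r ^ j') : γ = 0 := by
  have e : r ^ i = r ^ (i - j) * r ^ j := by
    rw [← zpow_add₀ hr.ne', sub_add_cancel]
  have e' : r ^ i' = r ^ (i - j) * r ^ j' := by
    rw [← zpow_add₀ hr.ne', hd, sub_add_cancel]
  rw [e] at h
  rw [e'] at h'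
  by_contra hγ
  have hc : α * r ^ (i - j) - β ≠ 0 := by
    intro hc
    exact hγ (by linear_combination (-1 : ℝ) * h + r ^ j * hc)
  exact hj (zpow_right_injective₀ hr hr1 (mul_left_cancel₀ hc (by linear_combination h - h')))

/-- Eigencoordinates of integer vectors. -/
theorem exists_eigencoordinates {n : ℕ} (M : Matrix.GeneralLinearGroup (Fin n) ℤ)
    {v : Fin n → Fin n → ℝ} {μ : Fin n → ℝ} (hv : LinearIndependent ℝ v) (hμ : ∀ k, μ k ≠ 0)
    (hMv : ∀ k, ((M : Matrix (Fin n) (Fin n) ℤ).map (fun x : ℤ => (x : ℝ))).mulVec (v k)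
      = μ k • v k) :
    ∃ c : Fin n → (Fin n → ℤ) → ℝ,
      (∀ k x y, c k (x + y) = c k x + c k y) ∧
      (∀ k (i : ℤ) x, c k (((M ^ i : Matrix.GeneralLinearGroup (Fin n) ℤ) :
        Matrix (Fin n) (Fin n) ℤ).mulVec x) = μ k ^ i * c k x) ∧
      ∀ x l, (x l : ℝ) = ∑ k, c k x * v k l := by
  classical
  have hspan : ⊤ ≤ Submodule.span ℝ (Set.range v) :=
    (hv.span_eq_top_of_card_eq_finrank' (by simp)).ge
  set b := Module.Basis.mk hv hspan
  have hb (k) : b k = v k := Module.Basis.mk_apply hv hspan k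
  set c : Fin n → (Fin n → ℤ) → ℝ := fun k x => b.repr (fun l => (x l : ℝ)) k with hc
  have hsum (x : Fin n → ℤ) : (fun l => (x l : ℝ)) = ∑ k, c k x • v k := by
    simpa [hb] using (b.sum_repr (fun l => (x l : ℝ))).symm
  have hstep (k) (x : Fin n → ℤ) :
      c k ((M : Matrix (Fin n) (Fin n) ℤ).mulVec x) = μ k * c k x := by
    have hcast : (fun l => (((M : Matrix (Fin n) (Fin n) ℤ).mulVec x l : ℤ) : ℝ)) =
        ((M : Matrix (Fin n) (Fin n) ℤ).map (fun x : ℤ => (x : ℝ))).mulVec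
          (fun l => (x l : ℝ)) := by
      ext l
      simp [Matrix.mulVec, dotProduct]
    have : ((M : Matrix (Fin n) (Fin n) ℤ).map (fun x : ℤ => (x : ℝ))).mulVec
          (fun l => (x l : ℝ)) = ∑ k, (μ k * c k x) • b k := by
      rw [hsum x, Matrix.mulVec_sum]
      refine Finset.sum_congr rfl fun k _ => ?_
      rw [Matrix.mulVec_smul, hMv, smul_smul, hb, mul_comm]
    simp only [hc]
    rw [hcast, this, b.repr_sum_self]
  refine ⟨c, ?_, ?_, ?_⟩
  · intro k x y
    have : (fun l => (((x + y) l : ℤ) : ℝ)) = (fun l => (x l : ℝ)) + fun l => (y l : ℝ) := by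
      ext l
      simp
    simp only [hc, this, map_add, Finsupp.add_apply]
  · intro k i
    induction i using Int.induction_on with
    | zero => simp
    | succ i ih =>
      intro x
      rw [zpow_add_one, Units.val_mul, ← Matrix.mulVec_mulVec, ih, hstep, zpow_add_one₀ (hμ k)]
      ring
    | pred i ih =>
      intro x
      have hinv : (M : Matrix (Fin n) (Fin n) ℤ).mulVec
          (((M⁻¹ : Matrix.GeneralLinearGroup (Fin n) ℤ) :
            Matrix (Fin n) (Fin n) ℤ).mulVec x) = x := by
        rw [Matrix.mulVec_mulVec, ← Units.val_mul, mul_inv_cancel]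
        simp
      have h := hstep k (((M⁻¹ : Matrix.GeneralLinearGroup (Fin n) ℤ) :
            Matrix (Fin n) (Fin n) ℤ).mulVec x)
      rw [hinv] at h
      rw [zpow_sub_one, Units.val_mul, ← Matrix.mulVec_mulVec, ih, h, zpow_sub_one₀ (hμ k)]
      field_simp [hμ k]
  · intro x l
    have := congrFun (hsum x) l
    simpa using this

/-- An integer vector all of whose nonzero eigencoordinates are contracted by a fixed power of
`M` vanishes. -/
theorem eq_zero_of_contracted {n : ℕ} (M : Matrix.GeneralLinearGroup (Fin n) ℤ)
    {v : Fin n → Fin n → ℝ} {μ : Fin n → ℝ} (hμ : ∀ k, 0 < μ k)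
    {c : Fin n → (Fin n → ℤ) → ℝ}
    (hc : ∀ k (i : ℤ) x, c k (((M ^ i : Matrix.GeneralLinearGroup (Fin n) ℤ) :
        Matrix (Fin n) (Fin n) ℤ).mulVec x) = μ k ^ i * c k x)
    (hsum : ∀ x l, (x l : ℝ) = ∑ k, c k x * v k l) (s : ℤ) {x : Fin n → ℤ}
    (hx : ∀ k, c k x ≠ 0 → μ k ^ s < 1) : x = 0 := by
  have hlim (l : Fin n) : Tendsto (fun N : ℕ =>
      (((((M ^ (s * N) : Matrix.GeneralLinearGroup (Fin n) ℤ) :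
        Matrix (Fin n) (Fin n) ℤ).mulVec x) l : ℤ) : ℝ)) atTop (𝓝 0) := by
    have h0 : (0 : ℝ) = ∑ k : Fin n, 0 * v k l := by simp
    simp only [hsum, hc]
    rw [h0]
    refine tendsto_finsetSum _ fun k _ => Tendsto.mul_const _ ?_
    by_cases hk : c k x = 0
    · simp [hk]
    · have := (tendsto_pow_atTop_nhds_zero_of_lt_one (zpow_pos (hμ k) s).le (hx k hk)).mul_const
        (c k x)
      simpa [zpow_mul] using this
  have hev : ∀ᶠ N : ℕ in atTop, ∀ l, (((M ^ (s * N) : Matrix.GeneralLinearGroup (Fin n) ℤ) :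
        Matrix (Fin n) (Fin n) ℤ).mulVec x) l = 0 := by
    refine eventually_all.2 fun l => ?_
    filter_upwards [(hlim l).eventually (Metric.ball_mem_nhds 0 one_pos)] with N hN
    rw [Real.dist_0_eq_abs, ← Int.cast_abs] at hN
    exact Int.abs_lt_one_iff.1 (by exact_mod_cast hN)
  obtain ⟨N, hN⟩ := hev.exists
  have h0 := congrArg (((M ^ (s * N))⁻¹ : Matrix.GeneralLinearGroup (Fin n) ℤ) :
    Matrix (Fin n) (Fin n) ℤ).mulVec (funext hN :
      ((M ^ (s * N) : Matrix.GeneralLinearGroup (Fin n) ℤ) :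
        Matrix (Fin n) (Fin n) ℤ).mulVec x = 0)
  simpa only [Matrix.mulVec_mulVec, ← Units.val_mul, inv_mul_cancel, Units.val_one,
    Matrix.one_mulVec, Matrix.mulVec_zero] using h0

/-- The equation `M ^ i z = a + M ^ j w` has no three solutions with distinct `i`
and nonconstant `j`. -/
theorem no_three_orbit_coincidences {n : ℕ} (M : Matrix.GeneralLinearGroup (Fin n) ℤ)
    {v : Fin n → Fin n → ℝ} {μ : Fin n → ℝ} (hv : LinearIndependent ℝ v)
    (hμ : ∀ k, 0 < μ k ∧ μ k ≠ 1)
    (hMv : ∀ k, ((M : Matrix (Fin n) (Fin n) ℤ).map (fun x : ℤ => (x : ℝ))).mulVec (v k)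
      = μ k • v k)
    {z w a : Fin n → ℤ} (hz : z ≠ 0) (ha : a ≠ 0) {i₁ i₂ i₃ j₁ j₂ j₃ : ℤ}
    (hi : i₁ < i₂) (hi' : i₂ < i₃) (hj : j₁ ≠ j₂)
    (h₁ : ((M ^ i₁ : Matrix.GeneralLinearGroup (Fin n) ℤ) : Matrix (Fin n) (Fin n) ℤ).mulVec z =
      a + ((M ^ j₁ : Matrix.GeneralLinearGroup (Fin n) ℤ) : Matrix (Fin n) (Fin n) ℤ).mulVec w)
    (h₂ : ((M ^ i₂ : Matrix.GeneralLinearGroup (Fin n) ℤ) : Matrix (Fin n) (Fin n) ℤ).mulVec z =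
      a + ((M ^ j₂ : Matrix.GeneralLinearGroup (Fin n) ℤ) : Matrix (Fin n) (Fin n) ℤ).mulVec w)
    (h₃ : ((M ^ i₃ : Matrix.GeneralLinearGroup (Fin n) ℤ) : Matrix (Fin n) (Fin n) ℤ).mulVec z =
      a + ((M ^ j₃ : Matrix.GeneralLinearGroup (Fin n) ℤ) : Matrix (Fin n) (Fin n) ℤ).mulVec w) :
    False := by
  obtain ⟨c, hadd, hc, hsum⟩ := exists_eigencoordinates M hv (fun k => (hμ k).1.ne') hMv
  have hcoord {i j : ℤ}
      (h : ((M ^ i : Matrix.GeneralLinearGroup (Fin n) ℤ) : Matrix (Fin n) (Fin n) ℤ).mulVec z =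
        a + ((M ^ j : Matrix.GeneralLinearGroup (Fin n) ℤ) : Matrix (Fin n) (Fin n) ℤ).mulVec w)
      (k : Fin n) : c k z * μ k ^ i = c k a + c k w * μ k ^ j := by
    have := congrArg (c k) h
    rw [hadd, hc, hc] at this
    linarith
  by_cases hd : i₁ - j₁ = i₂ - j₂
  · refine ha (funext fun l => ?_)
    have hzero (k) : c k a = 0 := const_eq_zero_of_zpow_solutions (hμ k).1 (hμ k).2 hj hd
      (hcoord h₁ k) (hcoord h₂ k)
    have := hsum a l
    simpa [hzero] using this
  have hne (k) (hk : c k z ≠ 0) : c k w ≠ 0 ∧ c k a ≠ 0 :=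
    coeffs_ne_zero_of_zpow_solutions (hμ k).1 (hμ k).2 hi.ne hd (hcoord h₁ k) (hcoord h₂ k) hk
  have hor (k) (hk : c k z ≠ 0) := orientation_of_zpow_solutions (hμ k).1 (hμ k).2 hk
    (hne k hk).1 (hne k hk).2 hi hi' (hcoord h₁ k) (hcoord h₂ k) (hcoord h₃ k)
  obtain ⟨k, hk, hk1⟩ : ∃ k, c k z ≠ 0 ∧ 1 ≤ μ k ^ (1 : ℤ) := by
    by_contra! h
    exact hz (eq_zero_of_contracted M (fun k => (hμ k).1) hc hsum 1 h)
  obtain ⟨k', hk', hk1'⟩ : ∃ k, c k z ≠ 0 ∧ 1 ≤ μ k ^ (-1 : ℤ) := by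
    by_contra! h
    exact hz (eq_zero_of_contracted M (fun k => (hμ k).1) hc hsum (-1) h)
  rw [zpow_one] at hk1
  rw [zpow_neg_one, one_le_inv₀ (hμ k').1] at hk1'
  have hlog : 0 < Real.log (μ k) := Real.log_pos (lt_of_le_of_ne hk1 (hμ k).2.symm)
  have hlog' : Real.log (μ k') < 0 := Real.log_neg (hμ k').1 (lt_of_le_of_ne hk1' (hμ k').2)
  rcases hor k hk with ⟨a₁, a₂, a₃⟩ | ⟨a₁, a₃⟩ | ⟨a₁, a₃⟩ <;>
    rcases hor k' hk' with ⟨b₁, b₂, b₃⟩ | ⟨b₁, b₃⟩ | ⟨b₁, b₃⟩ <;>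
    first
    | (have := Int.cast_lt (R := ℝ).2 hi'; linarith)
    | (have := pos_of_mul_pos_right a₃ hlog.le; nlinarith)
    | (have := neg_of_mul_neg_right a₃ hlog.le; nlinarith)


/-- For a hyperbolic automorphism `φ ∈ GL_n(ℤ)`, diagonalizable over `ℝ` with all
eigenvalues positive, the orbit of a nonzero `z` meets any translate `a + O_w`
(`a ≠ 0`) of the orbit of a nonzero `w` in at most two points. -/
theorem orbit_inter_translate_orbit_le_two {n : ℕ}
    (M : Matrix.GeneralLinearGroup (Fin n) ℤ)
    (hdiag : ∃ (v : Fin n → Fin n → ℝ) (μ : Fin n → ℝ),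
      LinearIndependent ℝ v ∧ (∀ i, 0 < μ i ∧ μ i ≠ 1) ∧
      ∀ i, ((M : Matrix (Fin n) (Fin n) ℤ).map (fun x : ℤ => (x : ℝ))).mulVec (v i)
        = μ i • v i)
    (z w a : Fin n → ℤ) (hz : z ≠ 0) (hw : w ≠ 0) (ha : a ≠ 0) :
    ∃ p q : Fin n → ℤ,
      {x : Fin n → ℤ | ∃ i : ℤ,
          x = ((M ^ i : Matrix.GeneralLinearGroup (Fin n) ℤ) :
            Matrix (Fin n) (Fin n) ℤ).mulVec z} ∩
      {x : Fin n → ℤ | ∃ i : ℤ,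
          x = a + ((M ^ i : Matrix.GeneralLinearGroup (Fin n) ℤ) :
            Matrix (Fin n) (Fin n) ℤ).mulVec w} ⊆ {p, q} := by
  obtain ⟨v, μ, hv, hμ, hMv⟩ := hdiag
  by_contra! hcon
  obtain ⟨x₁, ⟨⟨i₁, hi₁⟩, j₁, hj₁⟩, -⟩ := Set.not_subset.1 (hcon 0 0)
  obtain ⟨x₂, ⟨⟨i₂, hi₂⟩, j₂, hj₂⟩, hx₂⟩ := Set.not_subset.1 (hcon x₁ x₁)
  obtain ⟨x₃, ⟨⟨i₃, hi₃⟩, j₃, hj₃⟩, hx₃⟩ := Set.not_subset.1 (hcon x₁ x₂)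
  simp only [Set.mem_insert_iff, Set.mem_singleton_iff, or_self, not_or] at hx₂ hx₃
  obtain ⟨hx₃₁, hx₃₂⟩ := hx₃
  have hi₁₂ : i₁ ≠ i₂ := by rintro rfl; exact hx₂ (hi₂.trans hi₁.symm)
  have hi₁₃ : i₁ ≠ i₃ := by rintro rfl; exact hx₃₁ (hi₃.trans hi₁.symm)
  have hi₂₃ : i₂ ≠ i₃ := by rintro rfl; exact hx₃₂ (hi₃.trans hi₂.symm)
  have hj₁₂ : j₁ ≠ j₂ := by rintro rfl; exact hx₂ (hj₂.trans hj₁.symm)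
  have hj₁₃ : j₁ ≠ j₃ := by rintro rfl; exact hx₃₁ (hj₃.trans hj₁.symm)
  have hj₂₃ : j₂ ≠ j₃ := by rintro rfl; exact hx₃₂ (hj₃.trans hj₂.symm)
  have h₁ := hi₁.symm.trans hj₁
  have h₂ := hi₂.symm.trans hj₂
  have h₃ := hi₃.symm.trans hj₃
  rcases lt_or_gt_of_ne hi₁₂ with l₁₂ | l₁₂ <;> rcases lt_or_gt_of_ne hi₂₃ with l₂₃ | l₂₃
  · exact no_three_orbit_coincidences M hv hμ hMv hz ha l₁₂ l₂₃ hj₁₂ h₁ h₂ h₃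
  · rcases lt_or_gt_of_ne hi₁₃ with l₁₃ | l₁₃
    · exact no_three_orbit_coincidences M hv hμ hMv hz ha l₁₃ l₂₃ hj₁₃ h₁ h₃ h₂
    · exact no_three_orbit_coincidences M hv hμ hMv hz ha l₁₃ l₁₂ hj₁₃.symm h₃ h₁ h₂
  · rcases lt_or_gt_of_ne hi₁₃ with l₁₃ | l₁₃
    · exact no_three_orbit_coincidences M hv hμ hMv hz ha l₁₂ l₁₃ hj₁₂.symm h₂ h₁ h₃
    · exact no_three_orbit_coincidences M hv hμ hMv hz ha l₂₃ l₁₃ hj₂₃ h₂ h₃ h₁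
  · exact no_three_orbit_coincidences M hv hμ hMv hz ha l₂₃ l₁₂ hj₂₃.symm h₃ h₂ h₁
end

section
/- Let G = ℤⁿ ⋊_φ ℤ where φ ∈ GL_n(ℤ) is diagonalizable over ℝ with all eigenvalues real. Then every subgroup of G has bounded packing in G. -/
open Pointwise

/-- `d` is the word metric on `G` associated to some finite generating set. -/
def IsWordMetric {G : Type*} [Group G] (d : G → G → ℝ) : Prop :=
  ∃ S : Finset G, Subgroup.closure (S : Set G) = ⊤ ∧
    ∀ g h : G, d g h = sInf {x : ℝ | ∃ l : List G,
      (∀ w ∈ l, w ∈ S ∨ w⁻¹ ∈ S) ∧ l.prod = g⁻¹ * h ∧ (l.length : ℝ) = x}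

/-- `H` has bounded packing in `G` with respect to the distance function `d`:
for every `r > 0` there is `N` such that any `N` distinct left cosets of `H`
contain a pair of cosets at distance at least `r`. -/
def BoundedPacking {G : Type*} [Group G] (d : G → G → ℝ) (H : Subgroup G) : Prop :=
  ∀ r : ℝ, 0 < r → ∃ N : ℕ, ∀ C : Finset (Set G),
    (∀ X ∈ C, ∃ g : G, X = g • (H : Set G)) → N ≤ C.card →
    ∃ X ∈ C, ∃ Y ∈ C, X ≠ Y ∧ ∀ x ∈ X, ∀ y ∈ Y, r ≤ d x y


/-- The automorphism of `ℤⁿ` (written multiplicatively) induced by `M ∈ GL_n(ℤ)`. -/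
def matAut {n : ℕ} (M : Matrix.GeneralLinearGroup (Fin n) ℤ) :
    MulAut (Multiplicative (Fin n → ℤ)) :=
  AddEquiv.toMultiplicative
  { toFun := fun v => (M : Matrix (Fin n) (Fin n) ℤ).mulVec v
    invFun := fun v => ((M⁻¹ : Matrix.GeneralLinearGroup (Fin n) ℤ) :
      Matrix (Fin n) (Fin n) ℤ).mulVec v
    left_inv := fun v => by
      show ((M⁻¹ : Matrix.GeneralLinearGroup (Fin n) ℤ) :
        Matrix (Fin n) (Fin n) ℤ).mulVec ((M : Matrix (Fin n) (Fin n) ℤ).mulVec v) = v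
      rw [Matrix.mulVec_mulVec, ← Matrix.GeneralLinearGroup.coe_mul, inv_mul_cancel]
      simp
    right_inv := fun v => by
      show (M : Matrix (Fin n) (Fin n) ℤ).mulVec
        (((M⁻¹ : Matrix.GeneralLinearGroup (Fin n) ℤ) :
          Matrix (Fin n) (Fin n) ℤ).mulVec v) = v
      rw [Matrix.mulVec_mulVec, ← Matrix.GeneralLinearGroup.coe_mul, mul_inv_cancel]
      simp
    map_add' := fun v w => by
      show (M : Matrix (Fin n) (Fin n) ℤ).mulVec (v + w) = _
      rw [Matrix.mulVec_add] }

/-- The action of `ℤ` on `ℤⁿ` given by iterating `M ∈ GL_n(ℤ)`. -/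
def matAction {n : ℕ} (M : Matrix.GeneralLinearGroup (Fin n) ℤ) :
    Multiplicative ℤ →* MulAut (Multiplicative (Fin n → ℤ)) :=
  zpowersHom (MulAut (Multiplicative (Fin n → ℤ))) (matAut M)

/-- The semidirect product `ℤⁿ ⋊_φ ℤ`. -/
abbrev SDP {n : ℕ} (M : Matrix.GeneralLinearGroup (Fin n) ℤ) : Type :=
  SemidirectProduct (Multiplicative (Fin n → ℤ)) (Multiplicative ℤ) (matAction M)

/-- The generator `t` of the `ℤ`-factor of `ℤⁿ ⋊_φ ℤ`. -/
def tGen {n : ℕ} (M : Matrix.GeneralLinearGroup (Fin n) ℤ) : SDP M :=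
  SemidirectProduct.inr (Multiplicative.ofAdd (1 : ℤ))

theorem finite_range_zpow_smul {G X : Type*} [Group G] [MulAction G X] (g : G) (x : X)
    (h : (Set.range fun n : ℕ => g ^ n • x).Finite) :
    (Set.range fun l : ℤ => g ^ l • x).Finite := by
  obtain ⟨a, b, hab, he⟩ : ∃ a b : ℕ, a < b ∧ g ^ a • x = g ^ b • x := by
    by_contra! hne
    refine Set.infinite_range_of_injective (f := fun n : ℕ => g ^ n • x) ?_ h
    intro a b hab
    rcases lt_trichotomy a b with hlt | heq | hlt
    · exact absurd hab (hne a b hlt)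
    · exact heq
    · exact absurd hab.symm (hne b a hlt)
  obtain ⟨m, rfl⟩ := Nat.exists_eq_add_of_lt hab
  have hm : g ^ ((m : ℤ) + 1) • x = x := by
    have : g ^ (a + m + 1) = g ^ a * g ^ ((m : ℤ) + 1) := by
      rw [add_assoc, pow_add]; norm_cast
    rw [this, mul_smul] at he
    exact (smul_left_cancel _ he).symm
  refine ((Set.finite_Ico (0 : ℤ) (m + 1)).image fun l => g ^ l • x).subset ?_
  rintro _ ⟨l, rfl⟩
  refine ⟨l % (m + 1), ⟨Int.emod_nonneg _ (by omega), Int.emod_lt_of_pos _ (by omega)⟩, ?_⟩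
  have hfix : g ^ (((m : ℤ) + 1) * (l / (m + 1))) • x = x := by
    rw [zpow_mul]
    have : g ^ ((m : ℤ) + 1) ∈ MulAction.stabilizer G x := hm
    exact (MulAction.stabilizer G x).zpow_mem this _
  dsimp only
  conv_rhs => rw [← Int.emod_add_mul_ediv l (m + 1), zpow_add, mul_smul, hfix]

/-- Elements of finitely many infinite orbits of an automorphism with enough real eigenfunctionals
grow in one direction and shrink in the other. In a three-term relation among such elements the
exponents stay close together. -/
theorem exists_exponent_bound {G Q ι : Type*} [Group G] [AddCommGroup Q]
    [DistribMulAction G Q] [Fintype ι] (ψ : G)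
    (ℓ : ι → Q →+ ℝ) (c : ι → ℝ) (hℓ : ∀ i (l : ℤ) q, ℓ i (ψ ^ l • q) = c i ^ l * ℓ i q)
    (F : Finset Q) (hexp : ∀ f ∈ F, ∃ i, 1 < |c i| ∧ ℓ i f ≠ 0)
    (hcon : ∀ f ∈ F, ∃ i, 0 < |c i| ∧ |c i| < 1 ∧ ℓ i f ≠ 0) :
    ∃ C : ℤ, ∀ f ∈ F, ∀ f' ∈ F, ∀ f'' ∈ F, ∀ l m k : ℤ,
      ψ ^ l • f = ψ ^ m • f' + ψ ^ k • f'' → |l - m| ≤ C := by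
  classical
  set P : Q → ℝ := fun x => ∑ i with 1 < |c i|, |ℓ i x| with hP
  set R : Q → ℝ := fun x => ∑ i with (0 < |c i| ∧ |c i| < 1), |ℓ i x| with hR
  have tri (s : Finset ι) (x y : Q) :
      ∑ i ∈ s, |ℓ i (x + y)| ≤ ∑ i ∈ s, |ℓ i x| + ∑ i ∈ s, |ℓ i y| := by
    rw [← Finset.sum_add_distrib]
    exact Finset.sum_le_sum fun i _ => by rw [map_add]; exact abs_add_le _ _
  have Pneg (x : Q) : P (-x) = P x := by simp [hP]
  have Rneg (x : Q) : R (-x) = R x := by simp [hR]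
  have Ptri (x y : Q) : P (x + y) ≤ P x + P y := tri _ x y
  have Rtri (x y : Q) : R (x + y) ≤ R x + R y := tri _ x y
  have Pmono (x : Q) {l m : ℤ} (h : l ≤ m) : P (ψ ^ l • x) ≤ P (ψ ^ m • x) := by
    refine Finset.sum_le_sum fun i hi => ?_
    rw [hℓ, hℓ, abs_mul, abs_mul, abs_zpow, abs_zpow]
    gcongr
    exact (Finset.mem_filter.1 hi).2.le
  have Rmono (x : Q) {l m : ℤ} (h : l ≤ m) : R (ψ ^ m • x) ≤ R (ψ ^ l • x) := by
    refine Finset.sum_le_sum fun i hi => ?_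
    have hi := (Finset.mem_filter.1 hi).2
    rw [hℓ, hℓ, abs_mul, abs_mul, abs_zpow, abs_zpow]
    gcongr ?_ * _
    exact zpow_le_zpow_right_of_le_one₀ hi.1 hi.2.le h
  have Rpos (f) (hf : f ∈ F) : 0 < R f := by
    obtain ⟨i, h0, h1, hi⟩ := hcon f hf
    exact Finset.sum_pos' (fun _ _ => abs_nonneg _) ⟨i, by simp [abs_pos.1 h0, h1], abs_pos.2 hi⟩
  have Ptend (f) (hf : f ∈ F) :
      Filter.Tendsto (fun n : ℕ => P (ψ ^ (n : ℤ) • f)) Filter.atTop Filter.atTop := by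
    obtain ⟨i, h1, hi⟩ := hexp f hf
    refine Filter.tendsto_atTop_mono (f := fun n : ℕ => |c i| ^ n * |ℓ i f|) (fun n => ?_)
      ((tendsto_pow_atTop_atTop_of_one_lt h1).atTop_mul_const (abs_pos.2 hi))
    have : |c i| ^ n * |ℓ i f| = |ℓ i (ψ ^ (n : ℤ) • f)| := by
      rw [hℓ, abs_mul, zpow_natCast, abs_pow]
    rw [this]
    exact Finset.single_le_sum (f := fun i => |ℓ i (ψ ^ (n : ℤ) • f)|)
      (fun _ _ => abs_nonneg _) (by simp [h1])
  have Rtend (f) : Filter.Tendsto (fun n : ℕ => R (ψ ^ (n : ℤ) • f)) Filter.atTop (nhds 0) := by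
    have : Filter.Tendsto (fun n : ℕ => ∑ i with (0 < |c i| ∧ |c i| < 1), |c i| ^ n * |ℓ i f|)
        Filter.atTop (nhds (∑ i with (0 < |c i| ∧ |c i| < 1), 0 * |ℓ i f|)) :=
      tendsto_finsetSum _ fun i hi => (tendsto_pow_atTop_nhds_zero_of_lt_one (abs_nonneg _)
        (Finset.mem_filter.1 hi).2.2).mul_const _
    simp only [zero_mul, Finset.sum_const_zero] at this
    refine this.congr fun n => Finset.sum_congr rfl fun i _ => ?_
    rw [hℓ, abs_mul, zpow_natCast, abs_pow]
  obtain ⟨ε, hε, hεF⟩ : ∃ ε > 0, ∀ f ∈ F, ε ≤ R f := by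
    rcases F.eq_empty_or_nonempty with rfl | hne
    · exact ⟨1, one_pos, by simp⟩
    · obtain ⟨f, hf, hmin⟩ := F.exists_min_image R hne
      exact ⟨R f, Rpos f hf, hmin⟩
  obtain ⟨C₁, hC₁⟩ : ∃ C₁ : ℕ, ∀ f ∈ F, R (ψ ^ (C₁ : ℤ) • f) < ε / 2 :=
    ((Filter.eventually_all_finset F).2 fun f _ =>
      (Rtend f).eventually_lt_const (half_pos hε)).exists
  obtain ⟨B, hB⟩ : ∃ B : ℝ, ∀ f ∈ F, P (ψ ^ (C₁ : ℤ) • f) ≤ B :=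
    (F.image fun f => P (ψ ^ (C₁ : ℤ) • f)).bddAbove.imp fun B hB f hf =>
      hB (by simpa using ⟨f, hf, rfl⟩)
  obtain ⟨C₂, hC₁₂, hC₂⟩ : ∃ C₂ : ℕ, C₁ ≤ C₂ ∧ ∀ f ∈ F, 2 * B < P (ψ ^ (C₂ : ℤ) • f) :=
    ((Filter.eventually_ge_atTop C₁).and ((Filter.eventually_all_finset F).2 fun f hf =>
      (Ptend f hf).eventually_gt_atTop _)).exists
  have main : ∀ f ∈ F, ∀ f' ∈ F, ∀ f'' ∈ F, ∀ l k : ℤ, P (ψ ^ l • f) ≤ P f' + P (ψ ^ k • f'') →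
      R f' ≤ R (ψ ^ l • f) + R (ψ ^ k • f'') → l ≤ C₂ := by
    intro f hf f' hf' f'' hf'' l k h1 h2
    by_contra! hl
    have hP' : P f' ≤ B := by
      simpa using (Pmono f' (Int.natCast_nonneg C₁)).trans (hB f' hf')
    have hk : (C₁ : ℤ) ≤ k := by
      by_contra! hk
      linarith [Pmono f hl.le, Pmono f'' hk.le, hC₂ f hf, hB f'' hf'']
    linarith [hεF f' hf', hC₁ f hf, hC₁ f'' hf'', Rmono f (show (C₁ : ℤ) ≤ l by omega),
      Rmono f'' hk]
  refine ⟨C₂, fun f hf f' hf' f'' hf'' l m k h => abs_le.2 ⟨?_, ?_⟩⟩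
  · have e : ψ ^ (m - l) • f' = f + -(ψ ^ (k - l) • f'') := by
      have := congrArg (ψ ^ (-l) • ·) h
      simp only [smul_add, smul_smul, ← zpow_add, neg_add_cancel, zpow_zero, one_smul] at this
      rw [sub_eq_neg_add, sub_eq_neg_add, this]; abel
    have e' : f = ψ ^ (m - l) • f' + ψ ^ (k - l) • f'' := by rw [e]; abel
    have := main f' hf' f hf f'' hf'' (m - l) (k - l)
      (by rw [e]; exact (Ptri _ _).trans_eq (by rw [Pneg]))
      (by conv_lhs => rw [e']
          exact Rtri _ _)
    omega
  · have e : ψ ^ (l - m) • f = f' + ψ ^ (k - m) • f'' := by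
      have := congrArg (ψ ^ (-m) • ·) h
      simp only [smul_add, smul_smul, ← zpow_add, neg_add_cancel, zpow_zero, one_smul] at this
      rw [sub_eq_neg_add, sub_eq_neg_add, this]
    have e' : f' = ψ ^ (l - m) • f + -(ψ ^ (k - m) • f'') := by rw [e]; abel
    exact main f hf f' hf' f'' hf'' (l - m) (k - m) (by rw [e]; exact Ptri _ _)
      (by conv_lhs => rw [e']
          exact (Rtri _ _).trans_eq (by rw [Rneg]))

theorem exists_card_le_of_sub_mem_orbits {G Q ι : Type*} [Group G] [AddCommGroup Q]
    [DistribMulAction G Q] [Fintype ι] (ψ : G)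
    (ℓ : ι → Q →+ ℝ) (c : ι → ℝ) (hψ : ∀ i q, ℓ i (ψ • q) = c i * ℓ i q)
    (hfin : ∀ B : ℝ, {q : Q | ∀ i, |ℓ i q| ≤ B}.Finite) (F : Finset Q) :
    ∃ N : ℕ, ∀ S : Finset Q,
      (∀ a ∈ S, ∀ b ∈ S, a ≠ b → ∃ l : ℤ, ∃ f ∈ F, b - a = ψ ^ l • f) → S.card ≤ N := by
  classical
  have hℓ (i) (l : ℤ) (q : Q) : ℓ i (ψ ^ l • q) = c i ^ l * ℓ i q := by
    rcases eq_or_ne (c i) 0 with h0 | h0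
    · have hz (x : Q) : ℓ i x = 0 := by
        rw [← smul_inv_smul ψ x, hψ, h0, zero_mul]
      rw [hz, hz, mul_zero]
    induction l using Int.induction_on with
    | zero => simp
    | succ n ih =>
      rw [add_comm, zpow_add, zpow_one, mul_smul, zpow_add₀ h0, zpow_one, mul_assoc, ← ih]
      exact hψ i _
    | pred n ih =>
      have := hψ i (ψ ^ (-(n : ℤ) - 1) • q)
      have e : ψ • (ψ ^ (-(n : ℤ) - 1) • q) = ψ ^ (-(n : ℤ)) • q := by
        rw [smul_smul, ← zpow_one_add, add_sub_cancel]
      rw [e, ih] at this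
      rw [zpow_sub_one₀ h0]
      field_simp
      linarith
  have hbdd (q : Q) : ∃ B : ℝ, ∀ i, |ℓ i q| ≤ B :=
    (Finset.univ.image fun i => |ℓ i q|).bddAbove.imp fun B hB i => hB (by simp)
  have hexp (q : Q) (hq : ¬ (Set.range fun l : ℤ => ψ ^ l • q).Finite) :
      ∃ i, 1 < |c i| ∧ ℓ i q ≠ 0 := by
    by_contra! h
    obtain ⟨B, hB⟩ := hbdd q
    refine hq (finite_range_zpow_smul ψ q ((hfin B).subset ?_))
    rintro _ ⟨n, rfl⟩ i
    have := hℓ i n q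
    rw [zpow_natCast, zpow_natCast] at this
    rw [this, abs_mul, abs_pow]
    by_cases hc : 1 < |c i|
    · simpa [h i hc] using hB i
    · exact (mul_le_of_le_one_left (abs_nonneg _)
        (pow_le_one₀ (abs_nonneg _) (not_lt.1 hc))).trans (hB i)
  have hcon (q : Q) (hq : ¬ (Set.range fun l : ℤ => ψ ^ l • q).Finite) :
      ∃ i, 0 < |c i| ∧ |c i| < 1 ∧ ℓ i q ≠ 0 := by
    by_contra! h
    obtain ⟨B, hB⟩ := hbdd q
    have hinv := finite_range_zpow_smul ψ⁻¹ q ((hfin B).subset ?_)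
    · refine hq (hinv.subset ?_)
      rintro _ ⟨l, rfl⟩
      exact ⟨-l, by simp⟩
    rintro _ ⟨n, rfl⟩ i
    have := hℓ i (-n) q
    rw [zpow_neg, zpow_natCast, zpow_neg, zpow_natCast, ← inv_pow, ← inv_pow] at this
    rw [this, abs_mul, abs_pow, abs_inv]
    rcases (abs_nonneg (c i)).eq_or_lt with h0 | h0
    · refine (mul_le_of_le_one_left (abs_nonneg _) ?_).trans (hB i)
      rw [← h0, inv_zero]
      exact pow_le_one₀ le_rfl zero_le_one
    by_cases hc : |c i| < 1
    · simpa [h i h0 hc] using hB i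
    · exact (mul_le_of_le_one_left (abs_nonneg _)
        (pow_le_one₀ (by positivity) (inv_le_one_of_one_le₀ (not_lt.1 hc)))).trans (hB i)
  set F₁ := F.filter fun f => ¬ (Set.range fun l : ℤ => ψ ^ l • f).Finite with hF₁
  obtain ⟨C, hC⟩ := exists_exponent_bound ψ ℓ c hℓ F₁
    (fun f hf => hexp f (Finset.mem_filter.1 hf).2) (fun f hf => hcon f (Finset.mem_filter.1 hf).2)
  have hE : (⋃ f ∈ F.filter fun f => (Set.range fun l : ℤ => ψ ^ l • f).Finite,
      Set.range fun l : ℤ => ψ ^ l • f).Finite :=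
    Set.Finite.biUnion (Finset.finite_toSet _) fun f hf => (Finset.mem_filter.1 hf).2
  set E := insert 0 hE.toFinset with hEdef
  have dich (S : Finset Q)
      (hS : ∀ a ∈ S, ∀ b ∈ S, a ≠ b → ∃ l : ℤ, ∃ f ∈ F, b - a = ψ ^ l • f)
      (a) (ha : a ∈ S) (b) (hb : b ∈ S) (hab : b - a ∉ E) :
      ∃ l : ℤ, ∃ f ∈ F₁, b - a = ψ ^ l • f := by
    have hne : a ≠ b := by
      rintro rfl
      simp [hEdef] at hab
    obtain ⟨l, f, hf, h⟩ := hS a ha b hb hne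
    refine ⟨l, f, Finset.mem_filter.2 ⟨hf, fun hfin' => hab ?_⟩, h⟩
    refine Finset.mem_insert_of_mem (hE.mem_toFinset.2 ?_)
    exact Set.mem_biUnion (Finset.mem_coe.2 (Finset.mem_filter.2 ⟨hf, hfin'⟩)) ⟨l, h.symm⟩
  set T : ℤ → Finset Q := fun l =>
    (Finset.Icc (l - C) (l + C) ×ˢ F₁).image fun x => ψ ^ x.1 • x.2 with hT
  have hTcard (l : ℤ) : (T l).card ≤ (2 * C + 1).toNat * F₁.card := by
    refine Finset.card_image_le.trans ?_
    rw [Finset.card_product, Int.card_Icc]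
    gcongr
    omega
  refine ⟨E.card + E.card + (2 * C + 1).toNat * F₁.card, fun S hS => ?_⟩
  rcases S.eq_empty_or_nonempty with rfl | ⟨a, ha⟩
  · simp
  by_cases hall : ∀ b ∈ S, b - a ∈ E
  · have : S ⊆ E.image (· + a) := fun b hb => Finset.mem_image.2 ⟨b - a, hall b hb, by abel⟩
    exact (Finset.card_le_card this).trans (Finset.card_image_le.trans (by omega))
  push Not at hall
  obtain ⟨b, hb, hba⟩ := hall
  obtain ⟨m, f', hf', hbaeq⟩ := dich S hS a ha b hb hba
  have hsub : S ⊆ (E.image (· + a) ∪ E.image (· + b)) ∪ (T m).image (· + a) := by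
    intro x hx
    by_cases hxa : x - a ∈ E
    · exact Finset.mem_union_left _ (Finset.mem_union_left _
        (Finset.mem_image.2 ⟨x - a, hxa, by abel⟩))
    by_cases hxb : x - b ∈ E
    · exact Finset.mem_union_left _ (Finset.mem_union_right _
        (Finset.mem_image.2 ⟨x - b, hxb, by abel⟩))
    obtain ⟨l, f, hf, h⟩ := dich S hS a ha x hx hxa
    obtain ⟨k, f'', hf'', h'⟩ := dich S hS b hb x hx hxb
    have hrel : ψ ^ l • f = ψ ^ m • f' + ψ ^ k • f'' := by rw [← h, ← h', ← hbaeq]; abel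
    have hlm := abs_le.1 (hC f hf f' hf' f'' hf'' l m k hrel)
    refine Finset.mem_union_right _ (Finset.mem_image.2 ⟨x - a, ?_, by abel⟩)
    refine Finset.mem_image.2 ⟨(l, f), ?_, h.symm⟩
    simp only [Finset.mem_product, Finset.mem_Icc]
    exact ⟨⟨by omega, by omega⟩, hf⟩
  refine (Finset.card_le_card hsub).trans ((Finset.card_union_le _ _).trans ?_)
  gcongr
  · refine (Finset.card_union_le _ _).trans ?_
    exact add_le_add Finset.card_image_le Finset.card_image_le
  · exact Finset.card_image_le.trans (hTcard m)

theorem AddCommGroup.exists_coordinates (Q : Type*) [AddCommGroup Q] [AddGroup.FG Q] :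
    ∃ (k : ℕ) (e : Fin k → Q →+ ℤ), ∀ B : ℝ, {q : Q | ∀ j, |(e j q : ℝ)| ≤ B}.Finite := by
  obtain ⟨k, ι, _, p, hp, m, ⟨E⟩⟩ := AddCommGroup.equiv_free_prod_directSum_zmod Q
  have (i : ι) : NeZero (p i ^ m i) := ⟨pow_ne_zero _ (hp i).ne_zero⟩
  have hfin : Finite (DirectSum ι fun i => ZMod (p i ^ m i)) := by
    classical
    exact Finite.of_equiv _ (DFinsupp.equivFunOnFintype (β := fun i => ZMod (p i ^ m i))).symm
  refine ⟨k, fun j => (Finsupp.applyAddHom j).comp ((AddMonoidHom.fst _ _).comp E.toAddMonoidHom),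
    fun B => ?_⟩
  have hbox : (Set.pi Set.univ fun _ : Fin k => Set.Icc (-⌊B⌋) ⌊B⌋).Finite :=
    Set.Finite.pi fun _ => Set.finite_Icc _ _
  have h1 : {x : Fin k →₀ ℤ | ∀ j, |(x j : ℝ)| ≤ B}.Finite := by
    refine (hbox.preimage (f := fun x : Fin k →₀ ℤ => (x : Fin k → ℤ))
      DFunLike.coe_injective.injOn).subset fun x hx j _ => ?_
    have := hx j
    rw [← Int.cast_abs, ← Int.le_floor] at this
    exact abs_le.1 this
  refine ((h1.prod (Set.finite_univ (α := DirectSum ι fun i => ZMod (p i ^ m i)))).preimage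
    E.injective.injOn).subset fun q hq => ⟨hq, trivial⟩

/-- A quotient of `ℤⁿ` by a submodule invariant under a real-diagonalizable matrix has enough real
eigenfunctionals to detect finiteness. -/
theorem exists_eigenfunctionals {n : ℕ} (N : Matrix (Fin n) (Fin n) ℤ)
    (v : Fin n → Fin n → ℝ) (μ : Fin n → ℝ) (hv : LinearIndependent ℝ v)
    (hμ : ∀ i, (N.map fun x : ℤ => (x : ℝ)).mulVec (v i) = μ i • v i)
    (K : Submodule ℤ (Fin n → ℤ)) (hK : ∀ a ∈ K, N.mulVec a ∈ K) :
    ∃ (m : ℕ) (ℓ : Fin m → ((Fin n → ℤ) ⧸ K) →+ ℝ) (c : Fin m → ℝ),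
      (∀ i a, ℓ i (K.mkQ (N.mulVec a)) = c i * ℓ i (K.mkQ a)) ∧
      ∀ B : ℝ, {q | ∀ i, |ℓ i q| ≤ B}.Finite := by
  classical
  let b := basisOfPiSpaceOfLinearIndependent hv
  let cast : (Fin n → ℤ) →+ (Fin n → ℝ) := (Int.castAddHom ℝ).compLeft (Fin n)
  let N' : Module.End ℝ (Fin n → ℝ) := (N.map fun x : ℤ => (x : ℝ)).mulVecLin
  have hcast (a : Fin n → ℤ) : cast (N.mulVec a) = N' (cast a) := by
    ext i
    simp [cast, N', Matrix.mulVec, dotProduct]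
  let T : Module.End ℝ (Module.Dual ℝ (Fin n → ℝ)) := Module.Dual.transpose N'
  let W : Submodule ℝ (Module.Dual ℝ (Fin n → ℝ)) :=
    { carrier := {f | ∀ a ∈ K, f (cast a) = 0}
      zero_mem' := fun a _ => rfl
      add_mem' := fun hf hg a ha => by simp [hf a ha, hg a ha]
      smul_mem' := fun r f hf a ha => by simp [hf a ha] }
  have hTW : ∀ f ∈ W, T f ∈ W := fun f hf a ha => by
    change f (N' (cast a)) = 0
    rw [← hcast]
    exact hf _ (hK a ha)
  have hT : ⨆ r, T.genEigenspace r 1 = ⊤ := by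
    rw [eq_top_iff, ← b.dualBasis.span_eq, Submodule.span_le]
    rintro _ ⟨i, rfl⟩
    refine Submodule.mem_iSup_of_mem (μ i) (Module.End.mem_eigenspace_iff.2 (b.ext fun j => ?_))
    change b.dualBasis i (N' (b j)) = μ i * b.dualBasis i (b j)
    have : N' (b j) = μ j • b j := by simpa [b, N'] using hμ j
    rw [this, map_smul, smul_eq_mul]
    rcases eq_or_ne i j with rfl | hij
    · rfl
    · simp [hij.symm]
  let X : Set (Module.Dual ℝ (Fin n → ℝ)) := {f | f ∈ W ∧ ∃ r : ℝ, T f = r • f}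
  have hWX : W ≤ Submodule.span ℝ X := by
    rw [Submodule.eq_iSup_inf_genEigenspace 1 hTW hT]
    exact iSup_le fun r f hf => Submodule.subset_span
      ⟨hf.1, r, Module.End.mem_eigenspace_iff.1 hf.2⟩
  obtain ⟨Y, hYX, hY⟩ := (Submodule.fg_span_iff_fg_span_finset_subset X).1
    (IsNoetherian.noetherian (Submodule.span ℝ X))
  rw [hY] at hWX
  choose! c hc using fun f (hf : f ∈ X) => hf.2
  let desc (f : W) : ((Fin n → ℤ) ⧸ K) →+ ℝ :=
    QuotientAddGroup.lift K.toAddSubgroup ((f : Module.Dual ℝ (Fin n → ℝ)).toAddMonoidHom.comp cast)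
      fun a ha => f.2 a ha
  have hdesc (f : W) (a : Fin n → ℤ) : desc f (K.mkQ a) = f.1 (cast a) := rfl
  have : AddGroup.FG ((Fin n → ℤ) ⧸ K) := Module.Finite.iff_addGroup_fg.1 inferInstance
  obtain ⟨k, e, he⟩ := AddCommGroup.exists_coordinates ((Fin n → ℤ) ⧸ K)
  have hlift (j : Fin k) : ∃ f ∈ W, ∀ a, f (cast a) = (e j (K.mkQ a) : ℝ) := by
    let f : Module.Dual ℝ (Fin n → ℝ) :=
      (Pi.basisFun ℝ (Fin n)).constr ℝ fun i => (e j (K.mkQ (Pi.single i 1)) : ℝ)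
    have hf (a : Fin n → ℤ) : f (cast a) = (e j (K.mkQ a) : ℝ) := by
      have ha : a = ∑ i, a i • (Pi.single i 1 : Fin n → ℤ) := by
        simpa using (Pi.basisFun ℤ (Fin n)).sum_repr a |>.symm
      conv_rhs => rw [ha]
      simp [f, Module.Basis.constr_apply_fintype, cast, -zsmul_eq_mul, map_sum, map_zsmul]
    refine ⟨f, fun a ha => ?_, hf⟩
    rw [hf, Submodule.mkQ_apply, (Submodule.Quotient.mk_eq_zero K).2 ha, map_zero, Int.cast_zero]
  choose f hfW hf using hlift
  choose w hw using fun j => Submodule.mem_span_finset'.1 (hWX (hfW j))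
  let y := Y.equivFin
  refine ⟨Y.card, fun i => desc ⟨y.symm i, (hYX (y.symm i).2).1⟩, fun i => c (y.symm i),
    fun i a => ?_, fun B => ?_⟩
  · rw [hdesc, hdesc, hcast]
    exact LinearMap.congr_fun (hc _ (hYX (y.symm i).2)) (cast a)
  · refine (he (∑ j, ∑ g, |w j g| * |B|)).subset fun q hq j => ?_
    obtain ⟨a, rfl⟩ := K.mkQ_surjective q
    rw [← hf, ← hw, LinearMap.sum_apply]
    calc |∑ g : Y, (w j g • g.1) (cast a)| ≤ ∑ g : Y, |w j g| * |B| := by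
          refine (Finset.abs_sum_le_sum_abs _ _).trans (Finset.sum_le_sum fun g _ => ?_)
          rw [LinearMap.smul_apply, smul_eq_mul, abs_mul]
          refine mul_le_mul_of_nonneg_left ?_ (abs_nonneg _)
          have := hq (y g)
          rw [hdesc] at this
          simp only [Equiv.symm_apply_apply] at this
          exact this.trans (le_abs_self B)
      _ ≤ _ := Finset.single_le_sum (f := fun j => ∑ g, |w j g| * |B|)
          (fun _ _ => by positivity) (Finset.mem_univ j)

theorem IsWordMetric.exists_finset_of_lt {G : Type*} [Group G] {d : G → G → ℝ}
    (hd : IsWordMetric d) (r : ℝ) : ∃ B : Finset G, ∀ g h, d g h < r → g⁻¹ * h ∈ B := by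
  classical
  obtain ⟨S, hS, hd⟩ := hd
  set U : Set G := {w | w ∈ S ∨ w⁻¹ ∈ S} with hU
  have hUfin : U.Finite :=
    S.finite_toSet.union (S.finite_toSet.preimage (f := fun w : G => w⁻¹) inv_injective.injOn)
  have hfin (k : ℕ) : {g : G | ∃ l : List G, (∀ w ∈ l, w ∈ U) ∧ l.prod = g ∧ l.length = k}.Finite := by
    induction k with
    | zero =>
      refine (Set.finite_singleton (1 : G)).subset ?_
      rintro g ⟨l, -, rfl, hl⟩
      simp [List.length_eq_zero_iff.1 hl]
    | succ k ih =>
      refine (hUfin.mul ih).subset ?_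
      rintro g ⟨_ | ⟨w, l⟩, hl, rfl, hk⟩
      · simp at hk
      · rw [List.forall_mem_cons] at hl
        exact ⟨w, hl.1, l.prod, ⟨l, hl.2, rfl, by simpa using hk⟩, by simp⟩
  have hball := Set.Finite.biUnion (Set.finite_Iio ⌈r⌉₊) fun k _ => hfin k
  refine ⟨hball.toFinset, fun g h hlt => hball.mem_toFinset.2 ?_⟩
  rw [hd] at hlt
  obtain ⟨_, ⟨l, hl, hprod, rfl⟩, hlr⟩ := exists_lt_of_csInf_lt (by
    have hmem : g⁻¹ * h ∈ (Subgroup.closure (S : Set G)).toSubmonoid := by simp [hS]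
    rw [Subgroup.closure_toSubmonoid] at hmem
    obtain ⟨l, hl, hp⟩ := Submonoid.exists_list_of_mem_closure hmem
    exact ⟨_, l, hl, hp, rfl⟩) hlt
  exact Set.mem_biUnion (x := l.length) (Nat.lt_ceil.2 hlr) ⟨l, hl, hprod, rfl⟩

/-- Bounded packing of `H` reduces to a counting statement inside a subgroup `A` containing all
commutators. -/
theorem boundedPacking_of_commutator_le {G : Type*} [Group G] {d : G → G → ℝ}
    (hd : IsWordMetric d) (H A : Subgroup G) (hA : commutator G ≤ A)
    (hcount : ∀ F : Finset G, ∃ N : ℕ, ∀ S : Finset G, (∀ a ∈ S, a ∈ A) →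
      (∀ a ∈ S, ∀ b ∈ S, a ≠ b → a⁻¹ * b ∉ H ∧
        ∃ h ∈ H, ∃ f ∈ F, f ∈ A ∧ ∃ k ∈ H ⊓ A, a⁻¹ * b = h * (f * k) * h⁻¹) → S.card ≤ N) :
    BoundedPacking d H := by
  classical
  have hcomm (x y : G) : x * y * x⁻¹ * y⁻¹ ∈ A :=
    hA (Subgroup.commutator_mem_commutator (Subgroup.mem_top x) (Subgroup.mem_top y))
  intro r _
  obtain ⟨B, hB⟩ := hd.exists_finset_of_lt r
  choose! σ hσH hσA using fun (β : G) (hβ : ∃ s ∈ H, β * s ∈ A) => hβ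
  obtain ⟨N, hN⟩ := hcount (B.image fun β => β * σ β)
  refine ⟨B.card * N + 2, fun C hC hcard => ?_⟩
  by_contra! hclose
  have hclose' (X) (hX : X ∈ C) (Y) (hY : Y ∈ C) (hne : X ≠ Y) : ∃ x ∈ X, ∃ y ∈ Y, x⁻¹ * y ∈ B := by
    obtain ⟨x, hx, y, hy, hxy⟩ := hclose X hX Y hY hne
    exact ⟨x, hx, y, hy, hB x y hxy⟩
  obtain ⟨X₀, hX₀⟩ : C.Nonempty := Finset.card_pos.1 (by omega)
  obtain ⟨g₀, hg₀⟩ := hC X₀ hX₀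
  have hfiber (β : G) : (C.filter fun X => ∃ x ∈ X₀, x * β ∈ X).card ≤ N := by
    set D := C.filter fun X => ∃ x ∈ X₀, x * β ∈ X with hD
    have hrep : ∀ X ∈ D, ∃ h ∈ H, X = (g₀ * h * β) • (H : Set G) := by
      intro X hX
      obtain ⟨hXC, x, hx, hxX⟩ := Finset.mem_filter.1 hX
      obtain ⟨g, rfl⟩ := hC X hXC
      rw [hg₀, mem_leftCoset_iff] at hx
      rw [mem_leftCoset_iff] at hxX
      refine ⟨_, hx, ?_⟩
      rw [mul_inv_cancel_left]
      exact (leftCoset_eq_iff H).2 hxX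
    choose! η hηH hη using hrep
    set a : Set G → G := fun X => β⁻¹ * η X * β * (η X)⁻¹ with ha
    have hXa (X) (hX : X ∈ D) : X = (g₀ * β * a X) • (H : Set G) := by
      conv_lhs => rw [hη X hX]
      refine (leftCoset_eq_iff H).2 ?_
      convert H.inv_mem (hηH X hX) using 1
      simp only [ha]
      group
    have hinj : Set.InjOn a D := fun X hX Y hY h => by rw [hXa X hX, hXa Y hY, h]
    rw [← Finset.card_image_of_injOn hinj]
    refine hN _ ?_ ?_
    · simp only [Finset.mem_image]
      rintro _ ⟨X, -, rfl⟩
      simpa [ha] using hcomm β⁻¹ (η X)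
    · simp only [Finset.mem_image]
      rintro _ ⟨X, hX, rfl⟩ _ ⟨Y, hY, rfl⟩ hne
      have hXY : X ≠ Y := fun h => hne (by rw [h])
      refine ⟨fun hmem => hXY ?_, ?_⟩
      · rw [hXa X hX, hXa Y hY]
        refine (leftCoset_eq_iff H).2 ?_
        convert hmem using 1
        group
      · obtain ⟨x, hx, y, hy, hxy⟩ := hclose' X (Finset.mem_filter.1 hX).1 Y
          (Finset.mem_filter.1 hY).1 hXY
        rw [hXa X hX, mem_leftCoset_iff] at hx
        rw [hXa Y hY, mem_leftCoset_iff] at hy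
        set h₁ := (g₀ * β * a X)⁻¹ * x with hh₁
        set h₂ := (g₀ * β * a Y)⁻¹ * y with hh₂
        set γ := x⁻¹ * y with hγ
        have haA (Z) : a Z ∈ A := by simpa [ha] using hcomm β⁻¹ (η Z)
        have hnorm : A.Normal := ⟨fun z hz g => by
          simpa using A.mul_mem (hcomm g z) hz⟩
        have key : (a X)⁻¹ * a Y = h₁ * (γ * (h₂⁻¹ * h₁)) * h₁⁻¹ := by
          simp only [hh₁, hh₂, hγ]
          group
        have hγA : γ * (h₂⁻¹ * h₁) ∈ A := by
          have : γ * (h₂⁻¹ * h₁) = h₁⁻¹ * ((a X)⁻¹ * a Y) * h₁⁻¹⁻¹ := by rw [key]; group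
          rw [this]
          exact hnorm.conj_mem _ (A.mul_mem (A.inv_mem (haA X)) (haA Y)) _
        have hex : ∃ s ∈ H, γ * s ∈ A := ⟨_, H.mul_mem (H.inv_mem hy) hx, hγA⟩
        refine ⟨h₁, hx, γ * σ γ, ⟨γ, hxy, rfl⟩, hσA γ hex,
          (σ γ)⁻¹ * (h₂⁻¹ * h₁), ⟨?_, ?_⟩, ?_⟩
        · exact H.mul_mem (H.inv_mem (hσH γ hex)) (H.mul_mem (H.inv_mem hy) hx)
        · have : (σ γ)⁻¹ * (h₂⁻¹ * h₁) = (γ * σ γ)⁻¹ * (γ * (h₂⁻¹ * h₁)) := by group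
          rw [this]
          exact A.mul_mem (A.inv_mem (hσA γ hex)) hγA
        · rw [key]; group
  have hcover : C ⊆ insert X₀ (B.biUnion fun β => C.filter fun X => ∃ x ∈ X₀, x * β ∈ X) := by
    intro X hX
    rcases eq_or_ne X₀ X with rfl | hne
    · exact Finset.mem_insert_self _ _
    · obtain ⟨x, hx, y, hy, hxy⟩ := hclose' X₀ hX₀ X hX hne
      refine Finset.mem_insert_of_mem (Finset.mem_biUnion.2 ⟨_, hxy, ?_⟩)
      exact Finset.mem_filter.2 ⟨hX, x, hx, by simpa using hy⟩
  have h1 := (Finset.card_le_card hcover).trans (Finset.card_insert_le _ _)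
  have h2 := Finset.card_biUnion_le_card_mul B _ N fun β _ => hfiber β
  omega

theorem matAction_ofAdd_natCast {n : ℕ} (M : Matrix.GeneralLinearGroup (Fin n) ℤ) (m : ℕ)
    (a : Fin n → ℤ) :
    (matAction M (Multiplicative.ofAdd (m : ℤ)) (Multiplicative.ofAdd a)).toAdd
      = ((M : Matrix (Fin n) (Fin n) ℤ) ^ m).mulVec a := by
  induction m generalizing a with
  | zero => simp
  | succ m ih =>
    rw [pow_succ, ← Matrix.mulVec_mulVec, ← ih, Nat.cast_succ, ofAdd_add, map_mul, MulAut.mul_apply]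
    congr 2

theorem SemidirectProduct.conj_inl {N G : Type*} [CommGroup N] [Group G] {φ : G →* MulAut N}
    (s : N ⋊[φ] G) (v : N) : s * inl v * s⁻¹ = inl (φ s.right v) := by
  ext <;> simp [mul_comm]

theorem Matrix.map_pow_mulVec_eq_smul {n : ℕ} (A : Matrix (Fin n) (Fin n) ℤ) {v : Fin n → ℝ}
    {μ : ℝ} (h : (A.map fun x : ℤ => (x : ℝ)).mulVec v = μ • v) (m : ℕ) :
    ((A ^ m).map fun x : ℤ => (x : ℝ)).mulVec v = μ ^ m • v := by
  have hmap : ((A ^ m).map fun x : ℤ => (x : ℝ)) = (A.map fun x : ℤ => (x : ℝ)) ^ m :=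
    map_pow (Int.castRingHom ℝ).mapMatrix A m
  rw [hmap]
  induction m with
  | zero => simp
  | succ m ih =>
    rw [pow_succ, ← mulVec_mulVec, h, mulVec_smul, ih (map_pow (Int.castRingHom ℝ).mapMatrix A m),
      smul_smul, pow_succ']

/-- If `φ ∈ GL_n(ℤ)` is diagonalizable over `ℝ` (all eigenvalues real), then every
subgroup of `G = ℤⁿ ⋊_φ ℤ` has bounded packing in `G` with its word metric. -/
theorem bounded_packing_all_subgroups {n : ℕ}
    (M : Matrix.GeneralLinearGroup (Fin n) ℤ)
    (hdiag : ∃ (v : Fin n → Fin n → ℝ) (μ : Fin n → ℝ),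
      LinearIndependent ℝ v ∧
      ∀ i, ((M : Matrix (Fin n) (Fin n) ℤ).map (fun x : ℤ => (x : ℝ))).mulVec (v i)
        = μ i • v i)
    (d : SDP M → SDP M → ℝ) (hd : IsWordMetric d)
    (H : Subgroup (SDP M)) :
    BoundedPacking d H := by
  classical
  obtain ⟨v, μ, hv, hμ⟩ := hdiag
  let ρ : SDP M →* Multiplicative ℤ := SemidirectProduct.rightHom
  refine boundedPacking_of_commutator_le hd H ρ.ker (Abelianization.commutator_subset_ker ρ)
    fun F => ?_
  obtain ⟨m, hm⟩ : ∃ m : ℕ, (H.map ρ).toAddSubgroup' = AddSubgroup.zmultiples (m : ℤ) := by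
    obtain ⟨p, hp⟩ := Int.subgroup_cyclic (H.map ρ).toAddSubgroup'
    exact ⟨p.natAbs, by rw [hp, Int.zmultiples_natAbs, AddSubgroup.zmultiples_eq_closure]⟩
  let K : Submodule ℤ (Fin n → ℤ) :=
    (H.comap (SemidirectProduct.inl (φ := matAction M))).toAddSubgroup'.toIntSubmodule
  have hK (a : Fin n → ℤ) :
      a ∈ K ↔ (SemidirectProduct.inl (Multiplicative.ofAdd a) : SDP M) ∈ H := Iff.rfl
  let e : (Fin n → ℤ) ≃ₗ[ℤ] (Fin n → ℤ) :=
    (MulEquiv.toAdditive (matAction M (Multiplicative.ofAdd (m : ℤ)))).toIntLinearEquiv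
  have he (a : Fin n → ℤ) : e a = ((M : Matrix (Fin n) (Fin n) ℤ) ^ m).mulVec a :=
    matAction_ofAdd_natCast M m a
  have heK (a : Fin n → ℤ) : e a ∈ K ↔ a ∈ K := by
    obtain ⟨s, hs, hsm⟩ : ∃ s ∈ H, ρ s = Multiplicative.ofAdd (m : ℤ) := by
      have : (m : ℤ) ∈ (H.map ρ).toAddSubgroup' := hm ▸ AddSubgroup.mem_zmultiples _
      exact this
    have hconj : (SemidirectProduct.inl (Multiplicative.ofAdd (e a)) : SDP M)
        = s * SemidirectProduct.inl (Multiplicative.ofAdd a) * s⁻¹ := by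
      rw [SemidirectProduct.conj_inl]
      change _ = SemidirectProduct.inl (matAction M (ρ s) _)
      rw [hsm]
      rfl
    rw [hK, hK, hconj, H.mul_mem_cancel_right (H.inv_mem hs), H.mul_mem_cancel_left hs]
  have hmap : K.map (e : (Fin n → ℤ) →ₗ[ℤ] (Fin n → ℤ)) = K := by
    ext a
    refine ⟨?_, fun ha => ⟨e.symm a, (heK _).1 (by simpa using ha), by simp⟩⟩
    rintro ⟨b, hb, rfl⟩
    exact (heK b).2 hb
  let ψ : ((Fin n → ℤ) ⧸ K) ≃ₗ[ℤ] ((Fin n → ℤ) ⧸ K) := Submodule.Quotient.equiv K K e hmap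
  have hψ (a : Fin n → ℤ) : ψ • K.mkQ a = K.mkQ (e a) := rfl
  have hψz (j : ℤ) (a : Fin n → ℤ) : ψ ^ j • K.mkQ a = K.mkQ ((e ^ j) a) := by
    induction j with
    | zero => simp
    | succ j ih =>
      rw [add_comm, zpow_one_add, zpow_one_add, mul_smul, ih, hψ]
      rfl
    | pred j ih =>
      rw [sub_eq_neg_add, zpow_add, zpow_add, mul_smul, ih, zpow_neg_one, zpow_neg_one,
        inv_smul_eq_iff, hψ, ← LinearEquiv.mul_apply, mul_inv_cancel_left]
  have hez (j : ℤ) (a : Fin n → ℤ) :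
      (e ^ j) a = (matAction M (Multiplicative.ofAdd (j * m)) (Multiplicative.ofAdd a)).toAdd := by
    have hofAdd (j m : ℤ) (b : Multiplicative (Fin n → ℤ)) :
        matAction M (Multiplicative.ofAdd (j + m)) b
          = matAction M (Multiplicative.ofAdd j) (matAction M (Multiplicative.ofAdd m) b) := by
      rw [ofAdd_add, map_mul, MulAut.mul_apply]
    induction j with
    | zero => simp
    | succ j ih =>
      rw [add_comm, zpow_one_add, LinearEquiv.mul_apply, ih, add_mul, one_mul, hofAdd]
      rfl
    | pred j ih =>
      rw [sub_eq_neg_add, zpow_add, zpow_neg_one, LinearEquiv.mul_apply, ih, add_mul, neg_one_mul,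
        hofAdd, ofAdd_neg, map_inv]
      rfl
  obtain ⟨k, ℓ, c, hℓ, hfin⟩ := exists_eigenfunctionals ((M : Matrix (Fin n) (Fin n) ℤ) ^ m) v
    (fun i => μ i ^ m) hv (fun i => Matrix.map_pow_mulVec_eq_smul _ (hμ i) m) K
    fun a ha => by rw [← he]; exact (heK a).2 ha
  let q : SDP M → (Fin n → ℤ) ⧸ K := fun g => K.mkQ g.left.toAdd
  obtain ⟨N, hN⟩ := exists_card_le_of_sub_mem_orbits ψ ℓ c (fun i x => by
    obtain ⟨a, rfl⟩ := K.mkQ_surjective x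
    rw [hψ, he, hℓ]) hfin (F.image q)
  have hinl (g : SDP M) (hg : g ∈ ρ.ker) : g = SemidirectProduct.inl g.left :=
    SemidirectProduct.ext rfl hg
  refine ⟨N, fun S hSA hS => ?_⟩
  have hinj : Set.InjOn q S := by
    intro a ha b hb hab
    by_contra hne
    refine (hS a ha b hb hne).1 ?_
    rw [hinl a (hSA a ha), hinl b (hSA b hb), ← map_inv, ← map_mul]
    refine (hK (-a.left.toAdd + b.left.toAdd)).1 ?_
    rw [neg_add_eq_sub]
    exact (Submodule.Quotient.eq K).1 hab.symm
  rw [← Finset.card_image_of_injOn hinj]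
  refine hN _ ?_
  simp only [Finset.mem_image]
  rintro _ ⟨a, ha, rfl⟩ _ ⟨b, hb, rfl⟩ hne
  obtain ⟨-, h, hh, f, hf, hfA, κ, hκ, hrel⟩ := hS a ha b hb fun h => hne (by rw [h])
  obtain ⟨j, hj⟩ : ∃ j : ℤ, j * m = (ρ h).toAdd := by
    have : (ρ h).toAdd ∈ (H.map ρ).toAddSubgroup' := ⟨h, hh, rfl⟩
    rw [hm, AddSubgroup.mem_zmultiples_iff] at this
    simpa using this
  refine ⟨j, _, ⟨f, hf, rfl⟩, ?_⟩
  have hκK : κ.left.toAdd ∈ K := by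
    rw [hK]
    exact hinl κ hκ.2 ▸ hκ.1
  have hleft : b.left.toAdd - a.left.toAdd = (e ^ j) (f.left.toAdd + κ.left.toAdd) := by
    rw [hinl a (hSA a ha), hinl b (hSA b hb), hinl f hfA, hinl κ hκ.2, ← map_inv, ← map_mul,
      ← map_mul, SemidirectProduct.conj_inl] at hrel
    have := congrArg Multiplicative.toAdd (SemidirectProduct.inl_injective hrel)
    rw [hez, hj, ← neg_add_eq_sub]
    exact this
  change K.mkQ _ - K.mkQ _ = ψ ^ j • K.mkQ _
  rw [← map_sub, hleft, ← hψz, map_add, Submodule.mkQ_apply K κ.left.toAdd,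
    (Submodule.Quotient.mk_eq_zero K).2 hκK, add_zero]
end
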